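/- Let r₁,…,rₙ be distinct nonzero real numbers with r_k > 0 for 1 ≤ k ≤ p and r_k < 0 for p+1 ≤ k ≤ n (where 1 ≤ p ≤ n−1). Then (1/|V|) ∫₀^∞ ( |Σ_{k=1}^p (−1)^k V_k e^{−r_k x}| + |Σ_{k=p+1}^n (−1)^k V_k e^{r_k x}| ) dx = 1/|r₁r₂⋯rₙ|, where V = V(r₁,…,rₙ) and V_k = V(r₁,…,r_{k−1},r_{k+1},…,rₙ) are Vandermonde determinants. -/

import Mathlib

open MeasureTheory

/-- Vandermonde determinant of the real numbers `r₁, …, rₙ` with the `k`-th entry deleted. -/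
noncomputable def VandDelR {n : ℕ} (r : Fin (n + 1) → ℝ) (k : Fin (n + 1)) : ℝ :=
  (Matrix.vandermonde fun i : Fin n => r (k.succAbove i)).det

open Finset in
theorem Lagrange.nodalWeight_insert_mul_sub {ι F : Type*} [DecidableEq ι] [Field F]
    {r : ι → F} (hr : Function.Injective r) {s : Finset ι} {m k : ι} (hm : m ∉ s) (hkm : k ≠ m) :
    nodalWeight (insert m s) r k * (r k - r m) = nodalWeight s r k := by
  have hsub : r k - r m ≠ 0 := sub_ne_zero.mpr (hr.ne hkm)
  rw [nodalWeight, nodalWeight, erase_insert_of_ne hkm.symm,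
    prod_insert (fun h => hm (mem_of_mem_erase h))]
  field_simp

open Finset in
theorem Lagrange.sum_nodalWeight_eq_zero {ι F : Type*} [DecidableEq ι] [Field F]
    {r : ι → F} (hr : Function.Injective r) {s : Finset ι} (hs : 1 < #s) :
    ∑ k ∈ s, nodalWeight s r k = 0 := by
  have h := Lagrange.coeff_eq_sum (v := r) hr.injOn (s := s) (P := 1) (by
    rw [Polynomial.degree_one]; exact_mod_cast (by lia : 0 < #s))
  rw [Polynomial.coeff_one, if_neg (by lia)] at h
  simpa [nodalWeight] using h.symm

open Finset in
theorem Lagrange.sum_nodalWeight_div {ι F : Type*} [DecidableEq ι] [Field F]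
    {r : ι → F} (hr : Function.Injective r) {s : Finset ι} (hs : s.Nonempty)
    (h0 : ∀ k ∈ s, r k ≠ 0) :
    ∑ k ∈ s, nodalWeight s r k / r k = (-1) ^ (#s + 1) / ∏ k ∈ s, r k := by
  have h := Lagrange.eval_interpolate_not_at_node (v := r) (s := s) (x := 0) 1
    (fun k hk => (h0 k hk).symm)
  have hP : ∏ k ∈ s, r k ≠ 0 := prod_ne_zero_iff.mpr h0
  rw [interpolate_one hr.injOn hs, Polynomial.eval_one, eval_nodal] at h
  simp only [zero_sub, Pi.one_apply, mul_one, prod_neg, inv_neg, mul_neg, sum_neg_distrib] at h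
  simp only [div_eq_mul_inv]
  generalize ∑ k ∈ s, nodalWeight s r k * (r k)⁻¹ = S at h ⊢
  have hsq : ((-1 : F) ^ #s) * (-1) ^ #s = 1 := by rw [← mul_pow]; simp
  field_simp
  rw [pow_succ]
  linear_combination ((-1) ^ #s) * h - S * (∏ k ∈ s, r k) * hsq

theorem Lagrange.nodalWeight_neg {ι F : Type*} [DecidableEq ι] [Field F]
    (r : ι → F) {s : Finset ι} {k : ι} (hk : k ∈ s) :
    nodalWeight s (-r) k = (-1) ^ (s.card - 1) * nodalWeight s r k := by
  rw [nodalWeight, nodalWeight, ← Finset.card_erase_of_mem hk, ← Finset.prod_const,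
    ← Finset.prod_mul_distrib]
  refine Finset.prod_congr rfl fun j _ => ?_
  rw [Pi.neg_apply, Pi.neg_apply, ← neg_sub', inv_neg, neg_one_mul]

/-- The part over `u` of the divided difference of `y ↦ exp (-y * x)` at the nodes `r k`, `k ∈ s`. -/
noncomputable def partialExpDividedDiff {ι : Type*} [DecidableEq ι] (u s : Finset ι)
    (r : ι → ℝ) (x : ℝ) : ℝ :=
  ∑ k ∈ u, Lagrange.nodalWeight s r k * Real.exp (-(r k) * x)

section PartialExpDividedDiff

variable {ι : Type*} [DecidableEq ι] {r : ι → ℝ}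

theorem hasDerivAt_exp_mul_partialExpDividedDiff (hr : Function.Injective r)
    (u : Finset ι) {s : Finset ι} {m : ι} (hm : m ∉ s) (x : ℝ) :
    HasDerivAt (fun y => Real.exp (r m * y) * partialExpDividedDiff u (insert m s) r y)
      (-(Real.exp (r m * x) * partialExpDividedDiff (u.erase m) s r x)) x := by
  have hexp (a : ℝ) : HasDerivAt (fun y => Real.exp (a * y)) (Real.exp (a * x) * a) x := by
    simpa using ((hasDerivAt_id x).const_mul a).exp
  have hsum := HasDerivAt.fun_sum (u := u) (x := x) fun k _ =>
    (hexp (-(r k))).const_mul (Lagrange.nodalWeight (insert m s) r k)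
  refine ((hexp (r m)).mul hsum).congr_deriv ?_
  rw [partialExpDividedDiff, mul_assoc, ← mul_add, Finset.mul_sum, ← Finset.sum_add_distrib,
    ← mul_neg, ← Finset.sum_neg_distrib, ← Finset.sum_erase (a := m) u (by ring)]
  congr 1
  refine Finset.sum_congr rfl fun k hk => ?_
  rw [← Lagrange.nodalWeight_insert_mul_sub hr hm (Finset.ne_of_mem_erase hk)]
  ring

open Finset in
theorem sign_partialExpDividedDiff_self (hr : Function.Injective r) {s : Finset ι}
    (hs : s.Nonempty) {x : ℝ} (hx : 0 ≤ x) :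
    0 ≤ (-1) ^ (#s + 1) * partialExpDividedDiff s s r x := by
  induction hs using Finset.Nonempty.cons_induction generalizing x with
  | singleton a => simp [partialExpDividedDiff, Lagrange.nodalWeight, Real.exp_nonneg]
  | cons m s hm hs ih =>
    rw [cons_eq_insert, card_insert_of_notMem hm]
    have hd (y : ℝ) := (hasDerivAt_exp_mul_partialExpDividedDiff hr (insert m s) hm y).const_mul
      ((-1 : ℝ) ^ (#s + 1 + 1))
    have hmono := monotoneOn_of_deriv_nonneg (convex_Ici (0 : ℝ))
      (fun y _ => (hd y).continuousAt.continuousWithinAt)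
      (fun y _ => (hd y).differentiableAt.differentiableWithinAt) (fun y hy => by
        rw [interior_Ici] at hy
        rw [(hd y).deriv, erase_insert hm]
        have := mul_nonneg (Real.exp_nonneg (r m * y)) (ih (le_of_lt hy))
        rw [pow_succ]
        linarith)
    have h := hmono Set.self_mem_Ici (Set.mem_Ici.mpr hx) hx
    have hzero : partialExpDividedDiff (insert m s) (insert m s) r 0 = 0 := by
      simpa [partialExpDividedDiff] using Lagrange.sum_nodalWeight_eq_zero hr (s := insert m s)
        (by rw [card_insert_of_notMem hm]; have := hs.card_pos; lia)
    simp only [hzero, mul_zero] at h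
    rw [mul_left_comm] at h
    exact nonneg_of_mul_nonneg_right h (Real.exp_pos _)

open Finset Filter Topology in
theorem sign_partialExpDividedDiff_union (hr : Function.Injective r) {s t : Finset ι}
    (hs : s.Nonempty) (hpos : ∀ k ∈ s, 0 < r k) (hneg : ∀ k ∈ t, r k < 0) {x : ℝ} (hx : 0 ≤ x) :
    0 ≤ (-1) ^ (#s + 1) * partialExpDividedDiff s (t ∪ s) r x := by
  induction t using Finset.induction_on generalizing x with
  | empty => simpa using sign_partialExpDividedDiff_self hr hs hx
  | insert m t hmt ih =>
    have hm : r m < 0 := hneg m (mem_insert_self m t)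
    have hms : m ∉ s := fun h => (hpos m h).not_gt hm
    have hd (y : ℝ) := (hasDerivAt_exp_mul_partialExpDividedDiff hr s
      (s := t ∪ s) (m := m) (by simp [hmt, hms]) y).const_mul ((-1 : ℝ) ^ (#s + 1))
    have hanti := antitoneOn_of_deriv_nonpos (convex_Ici (0 : ℝ))
      (fun y _ => (hd y).continuousAt.continuousWithinAt)
      (fun y _ => (hd y).differentiableAt.differentiableWithinAt) (fun y hy => by
        rw [interior_Ici] at hy
        rw [(hd y).deriv, erase_eq_of_notMem hms]
        have := mul_nonneg (Real.exp_nonneg (r m * y))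
          (ih (fun k hk => hneg k (mem_insert_of_mem hk)) (le_of_lt hy))
        linarith)
    have hlim : Tendsto (fun y => (-1 : ℝ) ^ (#s + 1) * (Real.exp (r m * y) *
        partialExpDividedDiff s (insert m (t ∪ s)) r y)) atTop (𝓝 0) := by
      have hexp {a : ℝ} (ha : a < 0) : Tendsto (fun y => Real.exp (a * y)) atTop (𝓝 0) :=
        Real.tendsto_exp_atBot.comp (tendsto_id.const_mul_atTop_of_neg ha)
      have hsum : Tendsto (partialExpDividedDiff s (insert m (t ∪ s)) r) atTop (𝓝 0) := by
        have h := tendsto_finsetSum s fun k hk =>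
          (hexp (neg_lt_zero.mpr (hpos k hk))).const_mul
            (Lagrange.nodalWeight (insert m (t ∪ s)) r k)
        simp only [mul_zero, sum_const_zero] at h
        exact h
      simpa using ((hexp hm).mul hsum).const_mul ((-1 : ℝ) ^ (#s + 1))
    have h := le_of_tendsto hlim <| (eventually_ge_atTop x).mono fun y hy =>
      hanti (Set.mem_Ici.mpr hx) (Set.mem_Ici.mpr (hx.trans hy)) hy
    beta_reduce at h
    rw [mul_left_comm, ← insert_union] at h
    exact nonneg_of_mul_nonneg_right h (Real.exp_pos _)

end PartialExpDividedDiff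

theorem neg_one_pow_mul_VandDelR {n : ℕ} {r : Fin (n + 1) → ℝ} (hr : Function.Injective r)
    (k : Fin (n + 1)) :
    (-1) ^ (k : ℕ) * VandDelR r k =
      (-1) ^ n * (Matrix.vandermonde r).det * Lagrange.nodalWeight Finset.univ r k := by
  have hperm := Matrix.det_permute k.cycleRange.symm (Matrix.vandermonde r)
  have hprod : ((Matrix.vandermonde r).submatrix k.cycleRange.symm id).det =
      (∏ i, (r (k.succAbove i) - r k)) * VandDelR r k := by
    rw [show (Matrix.vandermonde r).submatrix k.cycleRange.symm id =
        Matrix.vandermonde (r ∘ k.cycleRange.symm) from rfl, VandDelR, Matrix.det_vandermonde,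
      Matrix.det_vandermonde, Fin.prod_univ_succ]
    simp [Fin.prod_Ioi_succ]
  have hweight : Lagrange.nodalWeight Finset.univ r k =
      (-1) ^ n * (∏ i, (r (k.succAbove i) - r k))⁻¹ := by
    rw [Lagrange.nodalWeight, ← Finset.compl_singleton, ← Fin.image_succAbove_univ,
      Finset.prod_image (Fin.succAbove_right_injective.injOn), ← Finset.prod_inv_distrib]
    simp_rw [← neg_sub (r (k.succAbove _)), inv_neg]
    rw [Finset.prod_neg, Finset.card_univ, Fintype.card_fin]
  have hne : ∏ i, (r (k.succAbove i) - r k) ≠ 0 :=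
    Finset.prod_ne_zero_iff.mpr fun i _ => sub_ne_zero.mpr (hr.ne (Fin.succAbove_ne k i))
  rw [hprod, Equiv.Perm.sign_symm, Fin.sign_cycleRange] at hperm
  push_cast at hperm
  have hn : ((-1 : ℝ) ^ n) * (-1) ^ n = 1 := by rw [← mul_pow]; simp
  have hk : ((-1 : ℝ) ^ (k : ℕ)) * (-1) ^ (k : ℕ) = 1 := by rw [← mul_pow]; simp
  rw [hweight]
  field_simp
  rw [pow_two, hn]
  linear_combination (-1) ^ (k : ℕ) * hperm + (Matrix.vandermonde r).det * hk

theorem integrableOn_sum_mul_exp {ι : Type*} (u : Finset ι) (c : ι → ℝ) {a : ι → ℝ}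
    (ha : ∀ k ∈ u, a k < 0) :
    IntegrableOn (fun x => ∑ k ∈ u, c k * Real.exp (a k * x)) (Set.Ioi 0) :=
  integrable_finsetSum u fun k hk => (integrableOn_exp_mul_Ioi (ha k hk) 0).const_mul (c k)

theorem integral_sum_mul_exp {ι : Type*} (u : Finset ι) (c : ι → ℝ) {a : ι → ℝ}
    (ha : ∀ k ∈ u, a k < 0) :
    ∫ x in Set.Ioi (0 : ℝ), ∑ k ∈ u, c k * Real.exp (a k * x) = -∑ k ∈ u, c k / a k := by
  rw [integral_finsetSum u fun k hk => (integrableOn_exp_mul_Ioi (ha k hk) 0).const_mul (c k),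
    ← Finset.sum_neg_distrib]
  refine Finset.sum_congr rfl fun k hk => ?_
  rw [integral_const_mul, integral_exp_mul_Ioi (ha k hk)]
  simp [div_eq_mul_inv]

theorem stmt10 (n : ℕ) (r : Fin (n + 1) → ℝ)
    (hinj : Function.Injective r)
    (p : ℕ) (hp1 : 1 ≤ p) (hpn : p ≤ n)
    (hpos : ∀ k : Fin (n + 1), (k : ℕ) < p → 0 < r k)
    (hneg : ∀ k : Fin (n + 1), p ≤ (k : ℕ) → r k < 0) :
    (1 / |(Matrix.vandermonde r).det|) *
      ∫ x in Set.Ioi (0 : ℝ),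
        (|∑ k ∈ Finset.univ.filter (fun k : Fin (n + 1) => (k : ℕ) < p),
            (-1 : ℝ) ^ ((k : ℕ) + 1) * VandDelR r k * Real.exp (-(r k) * x)| +
         |∑ k ∈ Finset.univ.filter (fun k : Fin (n + 1) => p ≤ (k : ℕ)),
            (-1 : ℝ) ^ ((k : ℕ) + 1) * VandDelR r k * Real.exp (r k * x)|) =
    1 / |∏ k : Fin (n + 1), r k| := by
  set A := Finset.univ.filter (fun k : Fin (n + 1) => (k : ℕ) < p) with hA
  set B := Finset.univ.filter (fun k : Fin (n + 1) => p ≤ (k : ℕ)) with hB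
  set V := (Matrix.vandermonde r).det with hV
  set c : Fin (n + 1) → ℝ := Lagrange.nodalWeight Finset.univ r with hc
  have hV0 : V ≠ 0 := Matrix.det_vandermonde_ne_zero_iff.mpr hinj
  have hposA : ∀ k ∈ A, 0 < r k := fun k hk => hpos k (by simpa [hA] using hk)
  have hnegB : ∀ k ∈ B, r k < 0 := fun k hk => hneg k (by simpa [hB] using hk)
  have hAne : A.Nonempty := ⟨0, by simp [hA]; lia⟩
  have hBne : B.Nonempty := ⟨Fin.last n, by simp [hB, hpn]⟩
  have hBA : B = Aᶜ := by ext k; simp [hA, hB]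
  have hunion : B ∪ A = Finset.univ := by rw [hBA, Finset.union_comm, Finset.union_compl]
  have hcard : A.card + B.card = n + 1 := by rw [hBA, Finset.card_add_card_compl, Fintype.card_fin]
  set ε : ℝ := (-1) ^ (A.card + 1) with hε
  have hεabs : |ε| = 1 := by simp [hε]
  have hsignA (x : ℝ) (hx : 0 ≤ x) : 0 ≤ ε * ∑ k ∈ A, c k * Real.exp (-(r k) * x) := by
    have h := sign_partialExpDividedDiff_union hinj hAne hposA hnegB hx
    rwa [hunion] at h
  have hsignB (x : ℝ) (hx : 0 ≤ x) : 0 ≤ -ε * ∑ k ∈ B, c k * Real.exp (r k * x) := by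
    have h := sign_partialExpDividedDiff_union (r := -r) (neg_injective.comp hinj) hBne (t := A)
      (fun k hk => neg_pos.mpr (hnegB k hk)) (fun k hk => neg_lt_zero.mpr (hposA k hk)) hx
    rw [Finset.union_comm, hunion, partialExpDividedDiff] at h
    simp only [Lagrange.nodalWeight_neg r (Finset.mem_univ _), Finset.card_univ, Fintype.card_fin,
      Nat.add_sub_cancel, Pi.neg_apply, neg_neg, mul_assoc, ← Finset.mul_sum] at h
    rw [← mul_assoc, ← pow_add, show B.card + 1 + n = A.card + 2 * B.card by lia, pow_add,
      pow_mul, neg_one_sq, one_pow, mul_one] at h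
    simpa [hε, pow_succ] using h
  have hfactor (u : Finset (Fin (n + 1))) (e : Fin (n + 1) → ℝ) :
      |∑ k ∈ u, (-1 : ℝ) ^ ((k : ℕ) + 1) * VandDelR r k * e k| = |V| * |∑ k ∈ u, c k * e k| := by
    have : ∑ k ∈ u, (-1 : ℝ) ^ ((k : ℕ) + 1) * VandDelR r k * e k =
        (-1) ^ (n + 1) * V * ∑ k ∈ u, c k * e k := by
      rw [Finset.mul_sum]
      refine Finset.sum_congr rfl fun k _ => ?_
      linear_combination (-e k) * neg_one_pow_mul_VandDelR hinj k
    rw [this, abs_mul, abs_mul, abs_pow, abs_neg, abs_one, one_pow, one_mul]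
  have hsum : ∑ k ∈ A, c k / r k + ∑ k ∈ B, c k / r k = (-1) ^ n / ∏ k, r k := by
    rw [hBA, Finset.sum_add_sum_compl, hc, Lagrange.sum_nodalWeight_div hinj Finset.univ_nonempty
      (fun k _ => (lt_or_ge (k : ℕ) p).elim (fun h => (hpos k h).ne') (fun h => (hneg k h).ne))]
    simp [pow_succ]
  simp only [hfactor, ← mul_add]
  rw [integral_const_mul, ← mul_assoc, one_div_mul_cancel (abs_ne_zero.mpr hV0), one_mul]
  have hint : ∫ x in Set.Ioi (0 : ℝ), (|∑ k ∈ A, c k * Real.exp (-(r k) * x)| +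
      |∑ k ∈ B, c k * Real.exp (r k * x)|) = ε * ((-1) ^ n / ∏ k, r k) := by
    have hA' : ∀ k ∈ A, -(r k) < 0 := fun k hk => neg_lt_zero.mpr (hposA k hk)
    rw [← hsum]
    calc _ = ∫ x in Set.Ioi (0 : ℝ), (ε * ∑ k ∈ A, c k * Real.exp (-(r k) * x) +
          -ε * ∑ k ∈ B, c k * Real.exp (r k * x)) := by
          refine setIntegral_congr_fun measurableSet_Ioi fun x hx => ?_
          have hx0 : 0 ≤ x := le_of_lt hx
          rw [← abs_of_nonneg (hsignA x hx0), ← abs_of_nonneg (hsignB x hx0), abs_mul, abs_mul,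
            abs_neg, hεabs, one_mul, one_mul]
      _ = _ := by
          rw [integral_add ((integrableOn_sum_mul_exp A c hA').const_mul ε)
            ((integrableOn_sum_mul_exp B c hnegB).const_mul (-ε)), integral_const_mul,
            integral_const_mul, integral_sum_mul_exp A c hA', integral_sum_mul_exp B c hnegB]
          simp only [div_neg, Finset.sum_neg_distrib]
          ring
  rw [← abs_of_nonneg (integral_nonneg fun x => add_nonneg (abs_nonneg _) (abs_nonneg _)), hint,
    abs_mul, hεabs, one_mul, abs_div, abs_pow, abs_neg, abs_one, one_pow]
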